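/- Let A₁, A₂, A₃, A₄ be pairwise transverse affine parabolic spaces in 𝔰𝔩ₙ(ℝ). Then β(A₁,A₂,A₃,A₄) + β(A₁,A₂,A₄,A₃) = 0. -/

import Mathlib

open Matrix

noncomputable section

abbrev Mn (n : ℕ) := Matrix (Fin n) (Fin n) ℝ

/-- Conjugation `Z ↦ g Z g⁻¹` as a linear map on matrices. -/
def AdM {n : ℕ} (g : Mn n) : Mn n →ₗ[ℝ] Mn n where
  toFun Z := g * Z * g⁻¹
  map_add' X Y := by simp [Matrix.add_mul, Matrix.mul_add]
  map_smul' c X := by simp [Matrix.smul_mul, Matrix.mul_smul]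

/-- Projection onto the diagonal part. -/
def pi0 {n : ℕ} : Mn n →ₗ[ℝ] Mn n where
  toFun Z := Matrix.diagonal (fun i => Z i i)
  map_add' X Y := by
    ext i j
    by_cases h : i = j <;> simp [Matrix.diagonal_apply, h]
  map_smul' c X := by
    ext i j
    by_cases h : i = j <;> simp [Matrix.diagonal_apply, h]

/-- The involution reversing the diagonal entries (on diagonal matrices). -/
def omega0 {n : ℕ} : Mn n →ₗ[ℝ] Mn n where
  toFun Z := Matrix.diagonal (fun i => Z i.rev i.rev)
  map_add' X Y := by
    ext i j
    by_cases h : i = j <;> simp [Matrix.diagonal_apply, h]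
  map_smul' c X := by
    ext i j
    by_cases h : i = j <;> simp [Matrix.diagonal_apply, h]

/-- Traceless matrices: 𝔰𝔩ₙ(ℝ). -/
def slSub (n : ℕ) : Submodule ℝ (Mn n) := LinearMap.ker (Matrix.traceLinearMap (Fin n) ℝ ℝ)

/-- Matrices vanishing below the diagonal (upper triangular). -/
def upTri (n : ℕ) : Submodule ℝ (Mn n) where
  carrier := {Z | ∀ i j : Fin n, j < i → Z i j = 0}
  add_mem' := by intro a b ha hb i j h; simp [Matrix.add_apply, ha i j h, hb i j h]
  zero_mem' := by intro i j h; rfl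
  smul_mem' := by intro c a ha i j h; simp [Matrix.smul_apply, ha i j h]

/-- Matrices vanishing above the diagonal (lower triangular). -/
def loTri (n : ℕ) : Submodule ℝ (Mn n) where
  carrier := {Z | ∀ i j : Fin n, i < j → Z i j = 0}
  add_mem' := by intro a b ha hb i j h; simp [Matrix.add_apply, ha i j h, hb i j h]
  zero_mem' := by intro i j h; rfl
  smul_mem' := by intro c a ha i j h; simp [Matrix.smul_apply, ha i j h]

/-- Diagonal matrices. -/
def diagSub (n : ℕ) : Submodule ℝ (Mn n) where
  carrier := {Z | ∀ i j : Fin n, i ≠ j → Z i j = 0}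
  add_mem' := by intro a b ha hb i j h; simp [Matrix.add_apply, ha i j h, hb i j h]
  zero_mem' := by intro i j h; rfl
  smul_mem' := by intro c a ha i j h; simp [Matrix.smul_apply, ha i j h]

/-- Strictly upper triangular matrices: 𝔫⁺. -/
def nplus (n : ℕ) : Submodule ℝ (Mn n) where
  carrier := {Z | ∀ i j : Fin n, j ≤ i → Z i j = 0}
  add_mem' := by intro a b ha hb i j h; simp [Matrix.add_apply, ha i j h, hb i j h]
  zero_mem' := by intro i j h; rfl
  smul_mem' := by intro c a ha i j h; simp [Matrix.smul_apply, ha i j h]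

/-- Strictly lower triangular matrices: 𝔫⁻. -/
def nminus (n : ℕ) : Submodule ℝ (Mn n) where
  carrier := {Z | ∀ i j : Fin n, i ≤ j → Z i j = 0}
  add_mem' := by intro a b ha hb i j h; simp [Matrix.add_apply, ha i j h, hb i j h]
  zero_mem' := by intro i j h; rfl
  smul_mem' := by intro c a ha i j h; simp [Matrix.smul_apply, ha i j h]

/-- 𝔟⁺ : traceless upper triangular matrices. -/
def bplus (n : ℕ) : Submodule ℝ (Mn n) := slSub n ⊓ upTri n

/-- 𝔟⁻ : traceless lower triangular matrices. -/
def bminus (n : ℕ) : Submodule ℝ (Mn n) := slSub n ⊓ loTri n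

/-- 𝔞 : traceless diagonal matrices. -/
def aSub (n : ℕ) : Submodule ℝ (Mn n) := slSub n ⊓ diagSub n

/-- A parabolic subspace of 𝔰𝔩ₙ(ℝ): a subspace of the form Ad(g)𝔟⁺ with g ∈ SLₙ(ℝ). -/
def IsParabolic {n : ℕ} (V : Submodule ℝ (Mn n)) : Prop :=
  ∃ g : Mn n, g.det = 1 ∧ V = (bplus n).map (AdM g)

/-- Two subspaces are transverse if together they span 𝔰𝔩ₙ(ℝ). -/
def Transv {n : ℕ} (V W : Submodule ℝ (Mn n)) : Prop := V ⊔ W = slSub n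

/-- A standardizer of an ordered transverse pair of parabolic subspaces. -/
def IsStd {n : ℕ} (h : Mn n) (V₁ V₂ : Submodule ℝ (Mn n)) : Prop :=
  h.det = 1 ∧ (bplus n).map (AdM h) = V₁ ∧ (bminus n).map (AdM h) = V₂

/-- ν*_{i,j} computed with the standardizer h. -/
def nustar {n : ℕ} (h : Mn n) : Mn n →ₗ[ℝ] Mn n := pi0 ∘ₗ AdM h⁻¹

/-- ν_{i,j} computed with the standardizer h. -/
def nuMap {n : ℕ} (h : Mn n) : Mn n →ₗ[ℝ] Mn n := AdM h ∘ₗ pi0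

/-- π_{i,j} computed with the standardizer h. -/
def piStd {n : ℕ} (h : Mn n) : Mn n →ₗ[ℝ] Mn n := AdM h ∘ₗ pi0 ∘ₗ AdM h⁻¹

/-- The commutator subspace [V,V]. -/
def commSub {n : ℕ} (V : Submodule ℝ (Mn n)) : Submodule ℝ (Mn n) :=
  Submodule.span ℝ {z | ∃ x ∈ V, ∃ y ∈ V, z = x * y - y * x}

/-- An affine parabolic space with direction V: an affine subspace X + V of 𝔰𝔩ₙ(ℝ)
whose direction V is a parabolic subspace. -/
def IsAffPara {n : ℕ} (A : Set (Mn n)) (V : Submodule ℝ (Mn n)) : Prop :=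
  IsParabolic V ∧ ∃ X : Mn n, X ∈ slSub n ∧ A = {Z | Z - X ∈ V}

/-- `IsCross b A₁ A₂ A₃ A₄ V₁ V₂ V₃ V₄` : b is a value of the affine cross ratio
β(A₁,A₂,A₃,A₄), computed with some choice of standardizers and intersection points. -/
def IsCross {n : ℕ} (b : Mn n) (A₁ A₂ A₃ A₄ : Set (Mn n))
    (V₁ V₂ V₃ V₄ : Submodule ℝ (Mn n)) : Prop :=
  ∃ h₁₄ h₂₃ : Mn n, ∃ X₁₃ X₂₄ : Mn n,
    IsStd h₁₄ V₁ V₄ ∧ IsStd h₂₃ V₂ V₃ ∧ X₁₃ ∈ A₁ ∩ A₃ ∧ X₂₄ ∈ A₂ ∩ A₄ ∧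
    b = nustar h₁₄ (X₁₃ - X₂₄) - nustar h₂₃ (X₁₃ - X₂₄)

/-- `IsTriple d A₂ A₃ A₄ V₂ V₃ V₄` : d is a value of the affine triple ratio
δ(A₂,A₃,A₄), computed with some choice of standardizers and points. -/
def IsTriple {n : ℕ} (d : Mn n) (A₂ A₃ A₄ : Set (Mn n))
    (V₂ V₃ V₄ : Submodule ℝ (Mn n)) : Prop :=
  ∃ h₂₃ h₃₂ h₃₄ h₄₃ h₄₂ h₂₄ : Mn n, ∃ X₂ X₃ X₄ : Mn n,
    IsStd h₂₃ V₂ V₃ ∧ IsStd h₃₂ V₃ V₂ ∧ IsStd h₃₄ V₃ V₄ ∧ IsStd h₄₃ V₄ V₃ ∧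
    IsStd h₄₂ V₄ V₂ ∧ IsStd h₂₄ V₂ V₄ ∧ X₂ ∈ A₂ ∧ X₃ ∈ A₃ ∧ X₄ ∈ A₄ ∧
    d = (nustar h₂₃ (X₂ - X₃) + nustar h₃₂ (X₂ - X₃))
      + (nustar h₃₄ (X₃ - X₄) + nustar h₄₃ (X₃ - X₄))
      + (nustar h₄₂ (X₄ - X₂) + nustar h₂₄ (X₄ - X₂))

/-- The affine action of (g,Y) ∈ SLₙ(ℝ) ⋉ 𝔰𝔩ₙ(ℝ) on 𝔰𝔩ₙ(ℝ). -/
def affMap {n : ℕ} (g Y : Mn n) : Mn n → Mn n := fun Z => g * Z * g⁻¹ + Y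

section BlockTriangular

variable {ι α : Type*} [Fintype ι] [LinearOrder α] {b : ι → α} {M N k Z : Matrix ι ι ℝ}

/-- The diagonal of a product of triangular matrices is the product of the diagonals. -/
lemma mul_apply_self_of_blockTriangular (hb : Function.Injective b)
    (hM : BlockTriangular M b) (hN : BlockTriangular N b) (i : ι) :
    (M * N) i i = M i i * N i i := by
  rw [Matrix.mul_apply]
  refine Finset.sum_eq_single i (fun j _ hj => ?_) (by simp)
  rcases lt_or_gt_of_ne (hb.ne hj) with h | h
  · rw [hM h, zero_mul]
  · rw [hN h, mul_zero]

variable [DecidableEq ι]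

/-- A matrix conjugating all strictly triangular elementary matrices into triangular matrices is
triangular. -/
lemma blockTriangular_of_conj_single (hk : IsUnit k.det)
    (h : ∀ i j, b i < b j → BlockTriangular (k * Matrix.single i j 1 * k⁻¹) b) :
    BlockTriangular k b := by
  intro a i hia
  by_contra hne
  let c : ι → Prop := fun x => b i < b x
  have hinv : BlockTriangular k⁻¹ c := by
    intro j l hlj
    have hj : b i < b j := by
      by_contra hj
      exact hlj.2 fun hj' => absurd hj' hj
    have hl : ¬ b i < b l := fun hl => hlj.2 fun _ => hl
    have hconj := h i j hj
    have := hconj ((not_lt.1 hl).trans_lt hia)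
    rw [Matrix.mul_assoc, Matrix.mul_apply, Finset.sum_eq_single i] at this
    · simpa [hne] using this
    · intro x _ hx
      simp [hx]
    · simp
  have hunit := k⁻¹.invertibleOfIsUnitDet (k.isUnit_nonsing_inv_det hk)
  have htri := blockTriangular_inv_of_blockTriangular hinv
  rw [Matrix.nonsing_inv_nonsing_inv _ hk] at htri
  exact hne (htri ⟨fun hi => absurd hi (lt_irrefl _), fun hle => lt_irrefl _ (hle hia)⟩)

/-- Conjugation by a triangular matrix preserves the diagonal of a triangular matrix. -/
lemma conj_apply_self_of_blockTriangular (hb : Function.Injective b) (hk : IsUnit k.det)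
    (hkb : BlockTriangular k b) (hZ : BlockTriangular Z b) (i : ι) :
    (k * Z * k⁻¹) i i = Z i i := by
  have hunit := k.invertibleOfIsUnitDet hk
  have hinv := blockTriangular_inv_of_blockTriangular hkb
  have hone : k i i * k⁻¹ i i = 1 := by
    rw [← mul_apply_self_of_blockTriangular hb hkb hinv, Matrix.mul_nonsing_inv _ hk,
      Matrix.one_apply_eq]
  rw [mul_apply_self_of_blockTriangular hb (hkb.mul hZ) hinv,
    mul_apply_self_of_blockTriangular hb hkb hZ, mul_right_comm, hone, one_mul]

end BlockTriangular

/-- On `Ad(h)𝔟`, with `𝔟` the traceless triangular matrices for some order, `ν*` does not depend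
on the choice of `h`. -/
lemma nustar_eq_of_map_eq {n : ℕ} {α : Type*} [LinearOrder α] {b : Fin n → α}
    (hb : Function.Injective b) {B : Submodule ℝ (Mn n)}
    (hB : ∀ Z, Z ∈ B ↔ Z.trace = 0 ∧ BlockTriangular Z b) {h h' Y : Mn n}
    (hh : h.det = 1) (hh' : h'.det = 1) (hmap : B.map (AdM h) = B.map (AdM h'))
    (hY : Y ∈ B.map (AdM h)) : nustar h Y = nustar h' Y := by
  have u : IsUnit h.det := by simp [hh]
  have u' : IsUnit h'.det := by simp [hh']
  have hk : IsUnit (h⁻¹ * h').det := by simp [hh, hh', Matrix.det_nonsing_inv]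
  have hkinv : (h⁻¹ * h')⁻¹ = h'⁻¹ * h := by
    rw [Matrix.mul_inv_rev, Matrix.nonsing_inv_nonsing_inv _ u]
  have hconj : ∀ Z ∈ B, BlockTriangular (h⁻¹ * h' * Z * (h⁻¹ * h')⁻¹) b := by
    intro Z hZ
    obtain ⟨W, hW, hWZ⟩ : AdM h' Z ∈ B.map (AdM h) := hmap ▸ Submodule.mem_map_of_mem hZ
    have hWZ' : h * W * h⁻¹ = h' * Z * h'⁻¹ := hWZ
    have : h⁻¹ * h' * Z * (h⁻¹ * h')⁻¹ = W := by
      calc _ = h⁻¹ * (h' * Z * h'⁻¹) * h := by simp only [hkinv, Matrix.mul_assoc]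
        _ = h⁻¹ * (h * (W * (h⁻¹ * h))) := by simp only [← hWZ', Matrix.mul_assoc]
        _ = W := by rw [Matrix.nonsing_inv_mul_cancel_left _ _ u, Matrix.nonsing_inv_mul _ u,
          Matrix.mul_one]
    rw [this]
    exact ((hB W).1 hW).2
  have htri : BlockTriangular (h⁻¹ * h') b := by
    refine blockTriangular_of_conj_single hk fun i j hij => hconj _ ((hB _).2 ⟨?_, ?_⟩)
    · exact Matrix.trace_single_eq_of_ne i j 1 (by rintro rfl; exact hij.false)
    · exact blockTriangular_single hij.le 1
  rw [hmap] at hY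
  obtain ⟨Z, hZ, rfl⟩ := hY
  have hl : h⁻¹ * (h' * Z * h'⁻¹) * h⁻¹⁻¹ = h⁻¹ * h' * Z * (h⁻¹ * h')⁻¹ := by
    simp only [Matrix.mul_inv_rev, Matrix.mul_assoc]
  have hr : h'⁻¹ * (h' * Z * h'⁻¹) * h'⁻¹⁻¹ = Z := by
    rw [Matrix.nonsing_inv_nonsing_inv _ u', Matrix.mul_assoc h',
      Matrix.nonsing_inv_mul_cancel_left _ _ u', Matrix.nonsing_inv_mul_cancel_right _ _ u']
  change Matrix.diagonal (fun i => (h⁻¹ * (h' * Z * h'⁻¹) * h⁻¹⁻¹) i i) =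
    Matrix.diagonal (fun i => (h'⁻¹ * (h' * Z * h'⁻¹) * h'⁻¹⁻¹) i i)
  rw [hl, hr]
  simp only [conj_apply_self_of_blockTriangular hb hk htri ((hB Z).1 hZ).2]

/-- On the first space of a transverse pair, `ν*` depends only on that space. -/
lemma IsStd.nustar_eq_of_mem_left {n : ℕ} {h h' Y : Mn n} {V W W' : Submodule ℝ (Mn n)}
    (hs : IsStd h V W) (hs' : IsStd h' V W') (hY : Y ∈ V) : nustar h Y = nustar h' Y :=
  nustar_eq_of_map_eq (b := id) (B := bplus n) Function.injective_id
    (fun _ => Iff.rfl) hs.1 hs'.1 (hs.2.1.trans hs'.2.1.symm) (hs.2.1.symm ▸ hY)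

/-- On the second space of a transverse pair, `ν*` depends only on that space. -/
lemma IsStd.nustar_eq_of_mem_right {n : ℕ} {h h' Y : Mn n} {V V' W : Submodule ℝ (Mn n)}
    (hs : IsStd h V W) (hs' : IsStd h' V' W) (hY : Y ∈ W) : nustar h Y = nustar h' Y :=
  nustar_eq_of_map_eq (b := OrderDual.toDual) (B := bminus n) OrderDual.toDual.injective
    (fun _ => Iff.rfl) hs.1 hs'.1 (hs.2.2.trans hs'.2.2.symm) (hs.2.2.symm ▸ hY)

lemma IsAffPara.sub_mem {n : ℕ} {A : Set (Mn n)} {V : Submodule ℝ (Mn n)} (hA : IsAffPara A V)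
    {X Y : Mn n} (hX : X ∈ A) (hY : Y ∈ A) : X - Y ∈ V := by
  obtain ⟨-, P, -, rfl⟩ := hA
  simpa using V.sub_mem hX hY

/-- Let A₁, A₂, A₃, A₄ be pairwise transverse affine parabolic spaces in
𝔰𝔩ₙ(ℝ). Then β(A₁,A₂,A₃,A₄) + β(A₁,A₂,A₄,A₃) = 0. -/
theorem affine_cross_ratio_antisymmetry (n : ℕ) (hn : 2 ≤ n)
    (A₁ A₂ A₃ A₄ : Set (Mn n)) (V₁ V₂ V₃ V₄ : Submodule ℝ (Mn n))
    (h₁ : IsAffPara A₁ V₁) (h₂ : IsAffPara A₂ V₂)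
    (h₃ : IsAffPara A₃ V₃) (h₄ : IsAffPara A₄ V₄)
    (t₁₂ : Transv V₁ V₂) (t₁₃ : Transv V₁ V₃) (t₁₄ : Transv V₁ V₄)
    (t₂₃ : Transv V₂ V₃) (t₂₄ : Transv V₂ V₄) (t₃₄ : Transv V₃ V₄) :
    ∀ b b' : Mn n, IsCross b A₁ A₂ A₃ A₄ V₁ V₂ V₃ V₄ →
      IsCross b' A₁ A₂ A₄ A₃ V₁ V₂ V₄ V₃ → b + b' = 0 := by
  rintro _ _ ⟨h₁₄, h₂₃, X₁₃, X₂₄, s₁₄, s₂₃, m₁₃, m₂₄, rfl⟩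
    ⟨h₁₃, h₂₄, X₁₄, X₂₃, s₁₃, s₂₄, m₁₄, m₂₃, rfl⟩
  have e₁ := s₁₄.nustar_eq_of_mem_left s₁₃ (h₁.sub_mem m₁₃.1 m₁₄.1)
  have e₂ := s₂₃.nustar_eq_of_mem_left s₂₄ (h₂.sub_mem m₂₃.1 m₂₄.1)
  have e₃ := s₂₃.nustar_eq_of_mem_right s₁₃ (h₃.sub_mem m₁₃.2 m₂₃.2)
  have e₄ := s₁₄.nustar_eq_of_mem_right s₂₄ (h₄.sub_mem m₁₄.2 m₂₄.2)
  simp only [map_sub] at e₁ e₂ e₃ e₄ ⊢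
  linear_combination (norm := module) e₁ - e₂ - e₃ + e₄

end
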